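/- Let G and H be finite simple graphs, each with at least four edges. If there is a bijection σ from the edge set of G to the edge set of H such that for every edge e of G the bipartition polynomials of the one-edge-deleted subgraphs coincide, B(G−e;x,y,z) = B(H−σ(e);x,y,z) for all x, y, z, then B(G;x,y,z) = B(H;x,y,z) for all x, y, z. (That is, every graph with at least four edges is polynomially reconstructible from its multiset of bipartition polynomials of one-edge-deleted subgraphs.) -/

import Mathlib

open Finset

open scoped Classical

/-- The edge boundary `∂W` of a vertex subset `W`: the edges of `G` with exactly one
endpoint in `W`. -/
noncomputable def edgeBoundary {V : Type*} [Fintype V] (G : SimpleGraph V) (W : Finset V) :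
    Finset (Sym2 V) :=
  G.edgeFinset.filter fun e => ∃ u ∈ W, ∃ v ∉ W, e = s(u, v)

/-- `N_{(V,F)}(W)`: the vertices outside `W` incident with at least one edge of `F`. -/
noncomputable def extNbr {V : Type*} [Fintype V] (F : Finset (Sym2 V)) (W : Finset V) :
    Finset V :=
  Finset.univ.filter fun v => v ∉ W ∧ ∃ e ∈ F, v ∈ e

/-- The bipartition polynomial
`B(G;x,y,z) = ∑_{W ⊆ V} x^{|W|} ∑_{F ⊆ ∂W} y^{|N_{(V,F)}(W)|} z^{|F|}`. -/
noncomputable def bipartitionPoly {V : Type*} [Fintype V] (G : SimpleGraph V)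
    {R : Type*} [CommRing R] (x y z : R) : R :=
  ∑ W : Finset V, x ^ W.card *
    ∑ F ∈ (edgeBoundary G W).powerset, y ^ (extNbr F W).card * z ^ F.card

namespace BPR

/-- crossing predicate -/
def Cr {V : Type*} (W : Finset V) (e : Sym2 V) : Prop := ∃ u ∈ W, ∃ v ∉ W, e = s(u, v)

/-- coefficient attached to an edge set -/
noncomputable def gg {V : Type*} [Fintype V] (F : Finset (Sym2 V)) (x y : ℝ) : ℝ :=
  ∑ W : Finset V, if ∀ e ∈ F, Cr W e then x ^ W.card * y ^ (extNbr F W).card else 0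

theorem B_eq {V : Type*} [Fintype V] (G : SimpleGraph V) (x y z : ℝ) :
    bipartitionPoly G x y z = ∑ F ∈ G.edgeFinset.powerset, gg F x y * z ^ F.card := by
  unfold bipartitionPoly gg
  simp_rw [Finset.sum_mul]
  rw [Finset.sum_comm]
  refine Finset.sum_congr rfl fun W _ => ?_
  rw [Finset.mul_sum]
  have : (edgeBoundary G W).powerset = G.edgeFinset.powerset.filter (fun F => ∀ e ∈ F, Cr W e) := by
    ext F
    rw [Finset.mem_filter, Finset.mem_powerset, Finset.mem_powerset]
    unfold edgeBoundary
    constructor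
    · intro h
      exact ⟨fun e he => (Finset.mem_filter.1 (h he)).1, fun e he => (Finset.mem_filter.1 (h he)).2⟩
    · intro h e he
      exact Finset.mem_filter.2 ⟨h.1 he, h.2 e he⟩
  rw [this, Finset.sum_filter]
  refine Finset.sum_congr rfl fun F _ => ?_
  split_ifs <;> ring

theorem edge_del {V : Type*} [Fintype V] (G : SimpleGraph V) (e : Sym2 V)
    [Fintype (G.deleteEdges {e}).edgeSet] :
    (G.deleteEdges {e}).edgeFinset = G.edgeFinset.erase e := by
  ext f
  simp [and_comm]

theorem kelly {V : Type*} [Fintype V] (G : SimpleGraph V) (x y z : ℝ) :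
    ∑ e : {e : Sym2 V // e ∈ G.edgeFinset}, bipartitionPoly (G.deleteEdges {(e : Sym2 V)}) x y z
      = ∑ F ∈ G.edgeFinset.powerset,
        ((G.edgeFinset.card : ℝ) - F.card) * gg F x y * z ^ F.card := by
  rw [Finset.sum_coe_sort G.edgeFinset (fun e => bipartitionPoly (G.deleteEdges {e}) x y z)]
  simp_rw [B_eq, edge_del]
  rw [Finset.sum_comm' (t' := G.edgeFinset.powerset) (s' := fun F => G.edgeFinset \ F)]
  · refine Finset.sum_congr rfl fun F hF => ?_
    rw [Finset.sum_const, nsmul_eq_mul, Finset.card_sdiff_of_subset (Finset.mem_powerset.1 hF),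
      Nat.cast_sub (Finset.card_le_card (Finset.mem_powerset.1 hF))]
    ring
  · intro e F
    simp only [Finset.mem_powerset, Finset.mem_sdiff, Finset.subset_erase]
    tauto

theorem coeff_sum {α : Type*} (s : Finset α) (c : α → ℝ) (d : α → ℕ) (k : ℕ) :
    (∑ a ∈ s, Polynomial.C (c a) * Polynomial.X ^ d a).coeff k = ∑ a ∈ s with d a = k, c a := by
  rw [Polynomial.finsetSum_coeff, Finset.sum_filter]
  refine Finset.sum_congr rfl fun a _ => ?_
  rw [Polynomial.coeff_C_mul_X_pow]
  simp only [eq_comm]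

theorem coeffs_eq {α β : Type*} (s : Finset α) (c : α → ℝ) (d : α → ℕ)
    (s' : Finset β) (c' : β → ℝ) (d' : β → ℕ)
    (h : ∀ z : ℝ, ∑ a ∈ s, c a * z ^ d a = ∑ a ∈ s', c' a * z ^ d' a) (k : ℕ) :
    ∑ a ∈ s with d a = k, c a = ∑ a ∈ s' with d' a = k, c' a := by
  rw [← coeff_sum, ← coeff_sum]
  congr 1
  apply Polynomial.funext
  intro z
  simpa [Polynomial.eval_finsetSum] using h z

theorem group_sum {α : Type*} (s : Finset α) (c : α → ℝ) (d : α → ℕ) (m : ℕ)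
    (hd : ∀ a ∈ s, d a ≤ m) (z : ℝ) :
    ∑ a ∈ s, c a * z ^ d a = ∑ k ∈ Finset.range (m + 1), (∑ a ∈ s with d a = k, c a) * z ^ k := by
  rw [← Finset.sum_fiberwise_of_maps_to (s := s) (t := Finset.range (m + 1)) (g := d)
    (fun a ha => Finset.mem_range.2 (Nat.lt_succ_of_le (hd a ha)))]
  refine Finset.sum_congr rfl fun k _ => ?_
  rw [Finset.sum_mul]
  refine Finset.sum_congr rfl fun a ha => ?_
  rw [(Finset.mem_filter.1 ha).2]

/-- top coefficient -/
noncomputable def tau {V : Type*} [Fintype V] (G : SimpleGraph V) (x y : ℝ) : ℝ :=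
  gg G.edgeFinset x y

theorem top_filter {V : Type*} (E : Finset (Sym2 V)) (f : Finset (Sym2 V) → ℝ) :
    ∑ F ∈ E.powerset with F.card = E.card, f F = f E := by
  have : E.powerset.filter (fun F => F.card = E.card) = {E} := by
    ext F
    simp only [Finset.mem_filter, Finset.mem_powerset, Finset.mem_singleton]
    exact ⟨fun h => Finset.eq_of_subset_of_card_le h.1 h.2.ge, fun h => by subst h; simp⟩
  rw [this, Finset.sum_singleton]

theorem diff_eq {V V' : Type*} [Fintype V] [Fintype V']
    (G : SimpleGraph V) (H : SimpleGraph V')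
    (σ : {e : Sym2 V // e ∈ G.edgeFinset} ≃ {e : Sym2 V' // e ∈ H.edgeFinset})
    (hσ : ∀ (e : {e : Sym2 V // e ∈ G.edgeFinset}) (x y z : ℝ),
      bipartitionPoly (G.deleteEdges {(e : Sym2 V)}) x y z =
        bipartitionPoly (H.deleteEdges {((σ e : Sym2 V'))}) x y z)
    (hm : G.edgeFinset.card = H.edgeFinset.card) (x y z : ℝ) :
    bipartitionPoly G x y z - bipartitionPoly H x y z
      = z ^ G.edgeFinset.card * (tau G x y - tau H x y) := by
  have key : ∀ z : ℝ, ∑ F ∈ G.edgeFinset.powerset,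
        ((G.edgeFinset.card : ℝ) - F.card) * gg F x y * z ^ F.card
      = ∑ F ∈ H.edgeFinset.powerset,
        ((H.edgeFinset.card : ℝ) - F.card) * gg F x y * z ^ F.card := by
    intro z
    rw [← kelly, ← kelly, ← Equiv.sum_comp σ]
    exact Finset.sum_congr rfl fun e _ => hσ e x y z
  have hk := coeffs_eq _ _ _ _ _ _ key
  rw [B_eq, B_eq, group_sum _ _ _ G.edgeFinset.card
    (fun F hF => Finset.card_le_card (Finset.mem_powerset.1 hF)),
    group_sum (H.edgeFinset.powerset) _ _ G.edgeFinset.card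
    (fun F hF => hm ▸ Finset.card_le_card (Finset.mem_powerset.1 hF)),
    Finset.sum_range_succ, Finset.sum_range_succ, top_filter]
  conv_lhs => enter [2, 2]; rw [hm, top_filter]
  have : ∀ k ∈ Finset.range G.edgeFinset.card,
      (∑ F ∈ G.edgeFinset.powerset with F.card = k, gg F x y) * z ^ k
      = (∑ F ∈ H.edgeFinset.powerset with F.card = k, gg F x y) * z ^ k := by
    intro k hk'
    rw [Finset.mem_range] at hk'
    have h := hk k
    have e1 : ∑ F ∈ G.edgeFinset.powerset with F.card = k,
        ((G.edgeFinset.card : ℝ) - F.card) * gg F x y = ((G.edgeFinset.card : ℝ) - k) *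
        ∑ F ∈ G.edgeFinset.powerset with F.card = k, gg F x y := by
      rw [Finset.mul_sum]
      refine Finset.sum_congr rfl fun F hF => ?_
      rw [(Finset.mem_filter.1 hF).2]
    have e2 : ∑ F ∈ H.edgeFinset.powerset with F.card = k,
        ((H.edgeFinset.card : ℝ) - F.card) * gg F x y = ((G.edgeFinset.card : ℝ) - k) *
        ∑ F ∈ H.edgeFinset.powerset with F.card = k, gg F x y := by
      rw [Finset.mul_sum]
      refine Finset.sum_congr rfl fun F hF => ?_
      rw [(Finset.mem_filter.1 hF).2, hm]
    rw [e1, e2] at h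
    have hne : (G.edgeFinset.card : ℝ) - k ≠ 0 := by
      have : (k : ℝ) < G.edgeFinset.card := by exact_mod_cast hk'
      linarith
    rw [mul_left_cancel₀ hne h]
  rw [Finset.sum_congr rfl this, ← hm]
  unfold tau
  ring

/-- at `y = 1` -/
theorem B_one {V : Type*} [Fintype V] (G : SimpleGraph V) (x z : ℝ) :
    bipartitionPoly G x 1 z = ∑ W : Finset V, (1 + z) ^ (edgeBoundary G W).card * x ^ W.card := by
  unfold bipartitionPoly
  refine Finset.sum_congr rfl fun W _ => ?_
  rw [mul_comm]
  congr 1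
  simp only [one_pow, one_mul]
  have := Finset.prod_one_add (f := fun _ => z) (s := edgeBoundary G W)
  simp only [Finset.prod_const] at this
  exact this.symm

theorem mem_bd {V : Type*} [Fintype V] (G : SimpleGraph V) (W : Finset V) (e : Sym2 V) :
    e ∈ edgeBoundary G W ↔ e ∈ G.edgeSet ∧ Cr W e := by
  simp [edgeBoundary, Cr]

theorem cr_mk {V : Type*} (W : Finset V) (a b : V) :
    Cr W s(a, b) ↔ (a ∈ W ∧ b ∉ W) ∨ (b ∈ W ∧ a ∉ W) := by
  unfold Cr
  constructor
  · rintro ⟨u, hu, v, hv, h⟩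
    rw [Sym2.eq_iff] at h
    rcases h with ⟨rfl, rfl⟩ | ⟨rfl, rfl⟩
    · exact Or.inl ⟨hu, hv⟩
    · exact Or.inr ⟨hu, hv⟩
  · rintro (⟨h1, h2⟩ | ⟨h1, h2⟩)
    · exact ⟨a, h1, b, h2, rfl⟩
    · exact ⟨b, h1, a, h2, Sym2.eq_swap⟩

theorem card_bd_single {V : Type*} [Fintype V] (G : SimpleGraph V) (v : V) :
    (edgeBoundary G {v}).card = G.degree v := by
  rw [← G.card_incidenceFinset_eq_degree]
  congr 1
  ext e
  rw [mem_bd]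
  induction e with
  | _ a b =>
    simp only [cr_mk, Finset.mem_singleton, SimpleGraph.mem_edgeSet,
      SimpleGraph.mem_incidenceFinset, SimpleGraph.mk'_mem_incidenceSet_iff]
    constructor
    · rintro ⟨h, (h1 | h1)⟩ 
      · exact ⟨h, Or.inl h1.1.symm⟩
      · exact ⟨h, Or.inr h1.1.symm⟩
    · rintro ⟨h, rfl | rfl⟩
      · exact ⟨h, Or.inl ⟨rfl, h.ne'⟩⟩
      · exact ⟨h, Or.inr ⟨rfl, h.ne⟩⟩

theorem sum_single {U : Type*} [Fintype U] (K : SimpleGraph U) (t : ℝ) :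
    ∑ W : Finset U with W.card = 1, t ^ (edgeBoundary K W).card = ∑ v, t ^ K.degree v := by
  symm
  refine Finset.sum_bij (fun v _ => {v}) ?_ ?_ ?_ ?_
  · simp
  · intro a _ b _ hab; simpa using hab
  · intro W hW
    obtain ⟨a, rfl⟩ := Finset.card_eq_one.1 (Finset.mem_filter.1 hW).2
    exact ⟨a, Finset.mem_univ _, rfl⟩
  · intro v _; rw [card_bd_single]

theorem deg_gen {V V' : Type*} [Fintype V] [Fintype V']
    (G : SimpleGraph V) (H : SimpleGraph V') (m : ℕ)
    (h : ∀ x z : ℝ, bipartitionPoly G x 1 z - bipartitionPoly H x 1 z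
      = z ^ m * (tau G x 1 - tau H x 1)) :
    ∃ c : ℝ, ∀ t : ℝ, ∑ v, t ^ G.degree v - ∑ v, t ^ H.degree v = c * (t - 1) ^ m := by
  have h1 : ∀ x, tau G x 1 - tau H x 1 = bipartitionPoly G x 1 1 - bipartitionPoly H x 1 1 := by
    intro x; rw [h]; simp
  refine ⟨∑ v, (1 + 1 : ℝ) ^ G.degree v - ∑ v, (1 + 1 : ℝ) ^ H.degree v, fun t => ?_⟩
  have hp : (∑ W : Finset V, Polynomial.C (t ^ (edgeBoundary G W).card) * Polynomial.X ^ W.card)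
      - (∑ W : Finset V', Polynomial.C (t ^ (edgeBoundary H W).card) * Polynomial.X ^ W.card)
      = Polynomial.C ((t - 1) ^ m) * ((∑ W : Finset V,
          Polynomial.C ((1 + 1 : ℝ) ^ (edgeBoundary G W).card) * Polynomial.X ^ W.card)
      - (∑ W : Finset V',
          Polynomial.C ((1 + 1 : ℝ) ^ (edgeBoundary H W).card) * Polynomial.X ^ W.card)) := by
    apply Polynomial.funext
    intro x
    have := h x (t - 1)
    rw [h1, B_one, B_one, B_one, B_one, add_sub_cancel] at this
    simp only [Polynomial.eval_sub, Polynomial.eval_finsetSum, Polynomial.eval_mul,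
      Polynomial.eval_C, Polynomial.eval_pow, Polynomial.eval_X]
    exact this
  have h3 := congrArg (fun p => Polynomial.coeff p 1) hp
  simp only [Polynomial.coeff_sub, coeff_sum, Polynomial.coeff_C_mul, sum_single] at h3
  rw [h3]; ring

theorem iso_le {V V' : Type*} [Fintype V] [Fintype V']
    (G : SimpleGraph V) (H : SimpleGraph V') (m : ℕ) (hm : 4 ≤ m)
    (hH : H.edgeFinset.card = m) (c : ℝ)
    (h : ∀ t : ℝ, ∑ v, t ^ G.degree v - ∑ v, t ^ H.degree v = c * (t - 1) ^ m) : c ≤ 0 := by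
  have hp : ∑ v, (Polynomial.C 1 * Polynomial.X ^ G.degree v : Polynomial ℝ)
      - ∑ v, (Polynomial.C 1 * Polynomial.X ^ H.degree v : Polynomial ℝ)
      = Polynomial.C c * (Polynomial.X + Polynomial.C (-1)) ^ m := by
    apply Polynomial.funext
    intro t
    simpa [Polynomial.eval_finsetSum, sub_eq_add_neg] using h t
  have hc : ∀ k, ((#{v | G.degree v = k} : ℕ) : ℝ) - (#{v | H.degree v = k} : ℕ)
      = c * ((-1) ^ (m - k) * (m.choose k)) := by
    intro k
    have := congrArg (fun p => Polynomial.coeff p k) hp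
    simp only [Polynomial.coeff_sub, coeff_sum, Polynomial.coeff_C_mul,
      Polynomial.coeff_X_add_C_pow] at this
    simpa using this
  by_contra hcpos
  push Not at hcpos
  have e1 := hc m
  have e2 := hc (m - 1)
  have s1 : m - (m - 1) = 1 := by omega
  rw [s1, Nat.choose_symm (by omega : 1 ≤ m)] at e2
  simp at e1 e2
  have c1 : (1:ℝ) ≤ c := by
    rw [← e1] at hcpos ⊢
    have : (#{v | H.degree v = m}) < (#{v | G.degree v = m}) := by
      have := sub_pos.1 hcpos
      exact_mod_cast this
    have : ((#{v | H.degree v = m} : ℕ) : ℝ) + 1 ≤ (#{v | G.degree v = m} : ℕ) := by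
      exact_mod_cast this
    linarith
  have c2 : m ≤ #{v | H.degree v = m - 1} := by
    have h0 : (0:ℝ) ≤ (#{v | G.degree v = m - 1} : ℕ) := Nat.cast_nonneg _
    have : (m:ℝ) ≤ (#{v | H.degree v = m - 1} : ℕ) := by nlinarith [(Nat.cast_nonneg m : (0:ℝ) ≤ m)]
    exact_mod_cast this
  have c3 : #{v | H.degree v = m - 1} * (m - 1) ≤ ∑ v, H.degree v := by
    rw [← smul_eq_mul, ← Finset.sum_const]
    calc _ = ∑ v with H.degree v = m - 1, H.degree v :=
          Finset.sum_congr rfl fun v hv => (Finset.mem_filter.1 hv).2.symm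
      _ ≤ _ := Finset.sum_le_sum_of_subset (Finset.filter_subset _ _)
  have c4 := H.sum_degrees_eq_twice_card_edges
  rw [hH] at c4
  have c5 : m * (m - 1) ≤ 2 * m := by
    calc m * (m-1) ≤ _ := Nat.mul_le_mul_right _ c2
      _ ≤ _ := c3
      _ = _ := c4
  obtain ⟨k, rfl⟩ : ∃ k, m = k + 4 := ⟨m - 4, by omega⟩
  have : k + 4 - 1 = k + 3 := by omega
  rw [this] at c5
  nlinarith

theorem iso_eq {V V' : Type*} [Fintype V] [Fintype V']
    (G : SimpleGraph V) (H : SimpleGraph V') (m : ℕ) (hm : 4 ≤ m)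
    (hG : G.edgeFinset.card = m) (hH : H.edgeFinset.card = m)
    (h : ∀ x z : ℝ, bipartitionPoly G x 1 z - bipartitionPoly H x 1 z
      = z ^ m * (tau G x 1 - tau H x 1)) :
    #{v | G.degree v = 0} = #{v | H.degree v = 0} := by
  obtain ⟨c, hc⟩ := deg_gen G H m h
  have h1 := iso_le G H m hm hH c hc
  have h2 := iso_le H G m hm hG (-c) (fun t => by linarith [hc t])
  have h3 : c = 0 := by linarith
  subst h3
  have := coeffs_eq Finset.univ (fun _ => 1)
    (fun v => G.degree v) Finset.univ (fun _ => 1) (fun v => H.degree v)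
    (fun z => by have := hc z; simp only [one_mul]; linarith) 0
  simp at this
  exact_mod_cast this

end BPR
namespace BPR

/-- isolated vertices -/
noncomputable def iso {V : Type*} [Fintype V] (G : SimpleGraph V) : Finset V :=
  Finset.univ.filter fun v => G.degree v = 0

theorem mem_iso {V : Type*} [Fintype V] (G : SimpleGraph V) (v : V) :
    v ∈ iso G ↔ ∀ w, ¬ G.Adj v w := by
  simp only [iso, Finset.mem_filter, Finset.mem_univ, true_and]
  rw [← SimpleGraph.card_neighborFinset_eq_degree, Finset.card_eq_zero,
    Finset.eq_empty_iff_forall_notMem]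
  simp

/-- full cut -/
def Full {V : Type*} [Fintype V] (G : SimpleGraph V) (W : Finset V) : Prop :=
  ∀ e ∈ G.edgeFinset, Cr W e

theorem extNbr_eq {V : Type*} [Fintype V] (G : SimpleGraph V) (W : Finset V) :
    extNbr G.edgeFinset W = (iso G)ᶜ \ W := by
  ext v
  simp only [extNbr, Finset.mem_filter, Finset.mem_univ, true_and, Finset.mem_sdiff,
    Finset.mem_compl, mem_iso]
  rw [and_comm]
  refine and_congr_left fun _ => ?_
  push Not
  constructor
  · rintro ⟨e, he, hv⟩
    obtain ⟨w, rfl⟩ := Sym2.mem_iff_exists.1 hv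
    exact ⟨w, by simpa using he⟩
  · rintro ⟨w, hw⟩
    exact ⟨s(v, w), by simpa using hw, by simp⟩

theorem full_union {V : Type*} [Fintype V] (G : SimpleGraph V) (A J : Finset V)
    (hJ : J ⊆ iso G) : Full G (A ∪ J) ↔ Full G A := by
  unfold Full
  refine forall_congr' fun e => forall_congr' fun he => ?_
  induction e with
  | _ a b =>
    have hab : G.Adj a b := by simpa using he
    have ha : a ∉ J := fun h => (mem_iso G a).1 (hJ h) b hab
    have hb : b ∉ J := fun h => (mem_iso G b).1 (hJ h) a hab.symm
    simp [cr_mk, ha, hb]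

theorem sum_split {V : Type*} [Fintype V] (I : Finset V) (f : Finset V → ℝ) :
    ∑ W : Finset V, f W = ∑ A ∈ Iᶜ.powerset, ∑ J ∈ I.powerset, f (A ∪ J) := by
  rw [← Finset.sum_product']
  refine Finset.sum_nbij' (fun W => (W \ I, W ∩ I)) (fun p => p.1 ∪ p.2) ?_ ?_ ?_ ?_ ?_
  · intro W _
    simp only [Finset.mem_product, Finset.mem_powerset]
    refine ⟨fun v hv => ?_, Finset.inter_subset_right⟩
    simp at hv ⊢
    exact hv.2
  · simp
  · intro W _
    exact Finset.sdiff_union_inter W I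
  · rintro ⟨A, J⟩ h
    simp only [Finset.mem_product, Finset.mem_powerset] at h
    have h1 : ∀ v ∈ A, v ∉ I := fun v hv => by simpa using h.1 hv
    have h2 : ∀ v ∈ J, v ∈ I := fun v hv => h.2 hv
    ext v
    · have := h1 v; have := h2 v
      simp; tauto
    · have := h1 v; have := h2 v
      simp; tauto
  · intro W _
    simp only [Finset.sdiff_union_inter]

theorem sum_pow_card (I : Finset V) (x y : ℝ) :
    ∑ J ∈ I.powerset, x ^ J.card * y ^ (I.card - J.card) = (x + y) ^ I.card := by
  rw [Finset.sum_pow_mul_eq_add_pow]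

theorem tau_eq {V : Type*} [Fintype V] (G : SimpleGraph V) (x y : ℝ) :
    tau G x y = (∑ A ∈ (iso G)ᶜ.powerset,
      if Full G A then x ^ A.card * y ^ ((iso G)ᶜ.card - A.card) else 0) * (x + 1) ^ (iso G).card := by
  unfold tau gg
  rw [sum_split (iso G), Finset.sum_mul]
  refine Finset.sum_congr rfl fun A hA => ?_
  rw [Finset.mem_powerset] at hA
  rw [← sum_pow_card, Finset.mul_sum]
  refine Finset.sum_congr rfl fun J hJ => ?_
  rw [Finset.mem_powerset] at hJ
  have hd : Disjoint A J := Finset.disjoint_of_subset_left hA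
    (Finset.disjoint_of_subset_right hJ disjoint_compl_left)
  have h1 := full_union G A J hJ
  unfold Full at h1
  have h2 : (extNbr G.edgeFinset (A ∪ J)).card = (iso G)ᶜ.card - A.card := by
    rw [extNbr_eq, ← Finset.card_sdiff_of_subset hA]
    congr 1
    ext v
    have := @hJ v
    simp only [Finset.mem_sdiff, Finset.mem_compl, Finset.mem_union]
    tauto
  rw [h2, Finset.card_union_of_disjoint hd]
  unfold Full
  by_cases hc : ∀ e ∈ G.edgeFinset, Cr A e
  · rw [if_pos (h1.2 hc), if_pos hc]; ring
  · rw [if_neg (fun h => hc (h1.1 h)), if_neg hc]; ring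

theorem tau_homog {V : Type*} [Fintype V] (G : SimpleGraph V) (x y : ℝ) (hy : y ≠ 0) :
    tau G x y * (x + y) ^ (iso G).card =
      y ^ Fintype.card V * tau G (x / y) 1 * (x + 1) ^ (iso G).card := by
  rw [tau_eq, tau_eq]
  have hn : Fintype.card V = (iso G)ᶜ.card + (iso G).card := by
    rw [add_comm, Finset.card_add_card_compl]
  have h1 : (∑ A ∈ (iso G)ᶜ.powerset,
      if Full G A then x ^ A.card * y ^ ((iso G)ᶜ.card - A.card) else 0)
      = y ^ ((iso G)ᶜ.card) * (∑ A ∈ (iso G)ᶜ.powerset,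
      if Full G A then (x / y) ^ A.card * 1 ^ ((iso G)ᶜ.card - A.card) else 0) := by
    rw [Finset.mul_sum]
    refine Finset.sum_congr rfl fun A hA => ?_
    have hA' := Finset.card_le_card (Finset.mem_powerset.1 hA)
    split_ifs
    · rw [← Nat.sub_add_cancel hA', pow_add, Nat.add_sub_cancel, div_pow]
      field_simp
      simp
    · simp
  have h2 : x / y + 1 = (x + y) / y := by field_simp
  rw [h1, h2, hn, pow_add, div_pow]
  field_simp

theorem B_cont {V : Type*} [Fintype V] (G : SimpleGraph V) (x z : ℝ) :
    Continuous fun y => bipartitionPoly G x y z := by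
  unfold bipartitionPoly
  fun_prop

/-- closed-set generating function -/
noncomputable def KK {V : Type*} [Fintype V] (G : SimpleGraph V) (x : ℝ) : ℝ :=
  ∑ W : Finset V, if ∀ a b, G.Adj a b → (a ∈ W ↔ b ∈ W) then x ^ W.card else 0

theorem B_closed {V : Type*} [Fintype V] (G : SimpleGraph V) (x : ℝ) :
    bipartitionPoly G x 1 (-1) = KK G x := by
  rw [B_one]
  unfold KK
  refine Finset.sum_congr rfl fun W _ => ?_
  have : (edgeBoundary G W).card = 0 ↔ ∀ a b, G.Adj a b → (a ∈ W ↔ b ∈ W) := by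
    rw [Finset.card_eq_zero, Finset.eq_empty_iff_forall_notMem]
    constructor
    · intro h a b hab
      have := h s(a, b)
      rw [mem_bd, cr_mk] at this
      simp only [SimpleGraph.mem_edgeSet, hab, true_and] at this
      tauto
    · intro h e
      induction e with
      | _ a b =>
        rw [mem_bd, cr_mk, SimpleGraph.mem_edgeSet]
        rintro ⟨h1, h2⟩
        have := h a b h1
        tauto
  split_ifs with hc
  · rw [this.2 hc]; simp
  · rw [add_neg_cancel, zero_pow (fun h => hc (this.1 h))]; simp

theorem finish {V V' : Type*} [Fintype V] [Fintype V']
    (G : SimpleGraph V) (H : SimpleGraph V') (m : ℕ)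
    (h : ∀ x y z : ℝ, bipartitionPoly G x y z - bipartitionPoly H x y z
      = z ^ m * (tau G x y - tau H x y))
    (hi : (iso G).card = (iso H).card) (hn : Fintype.card V = Fintype.card V')
    (hK : ∀ x, KK G x = KK H x) :
    ∀ x y z : ℝ, bipartitionPoly G x y z = bipartitionPoly H x y z := by
  have h1 : ∀ x, tau G x 1 = tau H x 1 := by
    intro x
    have := h x 1 (-1)
    rw [B_closed, B_closed, hK, sub_self] at this
    have h0 : ((-1 : ℝ)) ^ m ≠ 0 := by positivity
    have := (mul_eq_zero.1 this.symm).resolve_left h0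
    linarith
  intro x y z
  have hd : Dense (({0, -x} : Set ℝ)ᶜ) := (Set.toFinite ({0, -x} : Set ℝ)).countable.dense_compl ℝ
  have := Continuous.ext_on hd (B_cont G x z) (B_cont H x z) ?_
  · exact congrFun this y
  · intro y hy
    simp only [Set.mem_compl_iff, Set.mem_insert_iff, Set.mem_singleton_iff, not_or] at hy
    have e1 := tau_homog G x y hy.1
    have e2 := tau_homog H x y hy.1
    rw [h1, hn, hi, ← e2] at e1
    have h0 : (x + y) ^ (iso H).card ≠ 0 := pow_ne_zero _ (fun h => hy.2 (by linarith))
    have := mul_right_cancel₀ h0 e1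
    have := h x y z
    simp only
    rw [‹tau G x y = tau H x y›] at this
    linarith

/-! ### components -/

/-- component sizes -/
noncomputable def lam {V : Type*} [Fintype V] (G : SimpleGraph V) : Multiset ℕ :=
  (Finset.univ : Finset G.ConnectedComponent).val.map
    fun c => (Finset.univ.filter fun v => G.connectedComponentMk v = c).card

theorem lam_pos {V : Type*} [Fintype V] (G : SimpleGraph V) : ∀ r ∈ lam G, 0 < r := by
  intro r hr
  obtain ⟨c, _, rfl⟩ := Multiset.mem_map.1 hr
  rw [Finset.card_pos]
  induction c using SimpleGraph.ConnectedComponent.ind with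
  | _ v => exact ⟨v, by simp⟩

theorem KK_lam {V : Type*} [Fintype V] (G : SimpleGraph V) (x : ℝ) :
    KK G x = ((lam G).map fun r => 1 + x ^ r).prod := by
  unfold lam
  rw [Multiset.map_map]
  change _ = ∏ c : G.ConnectedComponent, (1 + x ^ (Finset.univ.filter fun v => G.connectedComponentMk v = c).card)
  rw [Finset.prod_one_add, Finset.powerset_univ]
  unfold KK
  rw [← Finset.sum_filter]
  symm
  refine Finset.sum_bij (fun S _ => Finset.univ.filter fun v => G.connectedComponentMk v ∈ S)
    ?_ ?_ ?_ ?_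
  · intro S _
    simp only [Finset.mem_filter, Finset.mem_univ, true_and]
    intro a b hab
    rw [SimpleGraph.ConnectedComponent.sound hab.reachable]
  · intro S _ T _ hST
    ext c
    induction c using SimpleGraph.ConnectedComponent.ind with
    | _ v =>
      have := congrArg (fun W => v ∈ W) hST
      simpa using this
  · intro W hW
    simp only [Finset.mem_filter, Finset.mem_univ, true_and] at hW
    have hr : ∀ a b, G.Reachable a b → (a ∈ W ↔ b ∈ W) := by
      rintro a b ⟨p⟩
      induction p with
      | nil => rfl
      | cons h _ ih => exact (hW _ _ h).trans ih
    refine ⟨W.image G.connectedComponentMk, Finset.mem_univ _, ?_⟩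
    ext v
    simp only [Finset.mem_filter, Finset.mem_univ, true_and, Finset.mem_image]
    constructor
    · rintro ⟨a, ha, hav⟩
      exact (hr a v (SimpleGraph.ConnectedComponent.exact hav)).1 ha
    · intro hv; exact ⟨v, hv, rfl⟩
  · intro S _
    rw [Finset.prod_pow_eq_pow_sum]
    congr 1
    rw [Finset.card_eq_sum_card_fiberwise (f := G.connectedComponentMk) (t := S)]
    · refine Finset.sum_congr rfl fun c hc => ?_
      congr 1
      ext v
      simp only [Finset.mem_filter, Finset.mem_univ, true_and]
      constructor
      · rintro rfl; exact ⟨hc, rfl⟩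
      · exact fun h => h.2
    · intro v hv; simpa using hv

theorem lam_inj_aux (k : ℕ) : ∀ M M' : Multiset ℕ, M.card + M'.card = k → (∀ r ∈ M, 0 < r) → (∀ r ∈ M', 0 < r) →
    (M.map fun r => (1 + Polynomial.X ^ r : Polynomial ℝ)).prod =
      (M'.map fun r => (1 + Polynomial.X ^ r : Polynomial ℝ)).prod → M = M' := by
  induction k using Nat.strong_induction_on with
  | _ k ih =>
  have step : ∀ M M' : Multiset ℕ, M.card + M'.card = k → (∀ r ∈ M, 0 < r) →
      (∀ r ∈ M', 0 < r) →
    (M.map fun r => (1 + Polynomial.X ^ r : Polynomial ℝ)).prod =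
      (M'.map fun r => (1 + Polynomial.X ^ r : Polynomial ℝ)).prod →
      ∀ r ∈ M, (∀ s ∈ M', s ≤ r) → M = M' := by
    intro M M' hk hM hM' h r hr hmax
    have hr0 := hM r hr
    have hz := Complex.isPrimitiveRoot_exp (2 * r) (by omega)
    set ζ := Complex.exp (2 * Real.pi * Complex.I / ((2 * r : ℕ) : ℂ)) with hζ
    have hneg : ζ ^ r = -1 := by
      have h2 : (ζ ^ r) ^ 2 = 1 := by rw [← pow_mul, mul_comm]; exact hz.pow_eq_one
      rcases (mul_self_eq_one_iff.1 ((sq (ζ ^ r)).symm.trans h2)) with h3 | h3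
      · exact absurd h3 (hz.pow_ne_one_of_pos_of_lt (by omega) (by omega))
      · exact h3
    have hev := congrArg (Polynomial.aeval ζ) h
    rw [map_multiset_prod, map_multiset_prod, Multiset.map_map, Multiset.map_map] at hev
    have hL : (M.map (⇑(Polynomial.aeval ζ) ∘ fun r => (1 + Polynomial.X ^ r : Polynomial ℝ))).prod = 0 := by
      rw [Multiset.prod_eq_zero_iff, Multiset.mem_map]
      exact ⟨r, hr, by simp [hneg]⟩
    rw [hL] at hev
    have hev := hev.symm
    rw [Multiset.prod_eq_zero_iff, Multiset.mem_map] at hev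
    obtain ⟨s, hs, hs0⟩ := hev
    simp at hs0
    have hs1 : ζ ^ (2 * s) = 1 := by
      have : ζ ^ s = -1 := by linear_combination hs0
      rw [mul_comm, pow_mul, this]; norm_num
    have hdvd := (hz.pow_eq_one_iff_dvd _).1 hs1
    have hle := Nat.le_of_dvd (by have := hM' s hs; omega) hdvd
    have hsr : s = r := le_antisymm (hmax s hs) (by omega)
    subst hsr
    obtain ⟨A, rfl⟩ := Multiset.exists_cons_of_mem hr
    obtain ⟨A', rfl⟩ := Multiset.exists_cons_of_mem hs
    congr 1
    simp only [Multiset.map_cons, Multiset.prod_cons, Multiset.card_cons] at h hk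
    refine ih _ ?_ A A' rfl (fun t ht => hM t (Multiset.mem_cons_of_mem ht))
      (fun t ht => hM' t (Multiset.mem_cons_of_mem ht)) (mul_left_cancel₀ ?_ h)
    · omega
    · intro h0
      have := congrArg (Polynomial.eval 1) h0
      norm_num at this
  intro M M' hk hM hM' h
  by_cases h0 : M + M' = 0
  · rw [add_eq_zero] at h0
    rw [h0.1, h0.2]
  · obtain ⟨r, hr, hrm⟩ : ∃ r ∈ M + M', ∀ s ∈ M + M', s ≤ r := by
      obtain ⟨r, hr, hm⟩ := Finset.exists_max_image (M + M').toFinset id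
        (by rw [Multiset.toFinset_nonempty]; exact h0)
      exact ⟨r, by simpa using hr, fun s hs => hm s (Multiset.mem_toFinset.2 hs)⟩
    rcases Multiset.mem_add.1 hr with hr | hr
    · exact step M M' hk hM hM' h r hr fun s hs => hrm s (Multiset.mem_add.2 (Or.inr hs))
    · exact (step M' M (by omega) hM' hM h.symm r hr
        fun s hs => hrm s (Multiset.mem_add.2 (Or.inl hs))).symm

theorem lam_inj {V V' : Type*} [Fintype V] [Fintype V']
    (G : SimpleGraph V) (H : SimpleGraph V') (h : ∀ x, KK G x = KK H x) : lam G = lam H := by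
  refine lam_inj_aux _ _ _ rfl (lam_pos G) (lam_pos H) (Polynomial.funext fun x => ?_)
  have := h x
  rw [KK_lam, KK_lam] at this
  rw [Polynomial.eval_multiset_prod, Polynomial.eval_multiset_prod, Multiset.map_map,
    Multiset.map_map]
  simpa using this

/-- size of the component of `v` -/
noncomputable def cs {V : Type*} [Fintype V] (G : SimpleGraph V) (v : V) : ℕ :=
  (Finset.univ.filter fun w => G.Reachable v w).card

/-- additive statistic -/
noncomputable def SS {V : Type*} [Fintype V] (G : SimpleGraph V) (φ : ℕ → ℝ) : ℝ :=
  ∑ v, φ (cs G v)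

theorem SS_lam {V : Type*} [Fintype V] (G : SimpleGraph V) (φ : ℕ → ℝ) :
    SS G φ = ((lam G).map fun r : ℕ => (r : ℝ) * φ r).sum := by
  unfold lam SS
  rw [Multiset.map_map]
  change _ = ∑ c : G.ConnectedComponent, _
  rw [← Finset.sum_fiberwise (g := G.connectedComponentMk)]
  refine Finset.sum_congr rfl fun c _ => ?_
  simp only [Function.comp]
  rw [← nsmul_eq_mul, ← Finset.sum_const]
  refine Finset.sum_congr rfl fun v hv => ?_
  congr 1
  unfold cs
  congr 1
  ext w
  have := (Finset.mem_filter.1 hv).2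
  subst this
  simp only [Finset.mem_filter, Finset.mem_univ, true_and, SimpleGraph.ConnectedComponent.eq]
  exact SimpleGraph.reachable_comm

theorem SS_of_KK {V V' : Type*} [Fintype V] [Fintype V']
    (G : SimpleGraph V) (H : SimpleGraph V') (h : ∀ x, KK G x = KK H x) (φ : ℕ → ℝ) :
    SS G φ = SS H φ := by
  rw [SS_lam, SS_lam, lam_inj G H h]

theorem KK_of_SS {V V' : Type*} [Fintype V] [Fintype V']
    (G : SimpleGraph V) (H : SimpleGraph V') (h : ∀ φ, SS G φ = SS H φ) (x : ℝ) :
    KK G x = KK H x := by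
  have hc : ∀ (M : Multiset ℕ) (r : ℕ), (M.map fun s : ℕ => (s:ℝ) * (if s = r then 1 else 0)).sum
      = r * M.count r := by
    intro M r
    induction M using Multiset.induction_on with
    | empty => simp
    | cons a M ih =>
      rw [Multiset.map_cons, Multiset.sum_cons, ih, Multiset.count_cons]
      by_cases har : a = r
      · subst har; simp; ring
      · simp [har, Ne.symm har]
  have : lam G = lam H := by
    ext r
    by_cases hr : r = 0
    · subst hr
      rw [Multiset.count_eq_zero_of_notMem (fun h => (lam_pos G 0 h).ne rfl),
        Multiset.count_eq_zero_of_notMem (fun h => (lam_pos H 0 h).ne rfl)]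
    · have := h (fun s => if s = r then 1 else 0)
      rw [SS_lam, SS_lam, hc, hc] at this
      have := mul_left_cancel₀ (Nat.cast_ne_zero.2 hr) this
      exact_mod_cast this
  rw [KK_lam, KK_lam, this]

end BPR
namespace BPR

section del
variable {V : Type*} [Fintype V] (G : SimpleGraph V)

theorem del_adj (u v a b : V) : (G.deleteEdges {s(u, v)}).Adj a b ↔ G.Adj a b ∧ s(a, b) ≠ s(u, v) := by
  simp [SimpleGraph.deleteEdges_adj]

theorem reach_del {u v : V} (huv : G.Adj u v) (a b : V) :
    G.Reachable a b ↔ (G.deleteEdges {s(u, v)}).Reachable a b ∨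
      ((G.deleteEdges {s(u, v)}).Reachable a u ∧ (G.deleteEdges {s(u, v)}).Reachable v b) ∨
      ((G.deleteEdges {s(u, v)}).Reachable a v ∧ (G.deleteEdges {s(u, v)}).Reachable u b) := by
  set G' := G.deleteEdges {s(u, v)} with hG'
  have hle : G' ≤ G := SimpleGraph.deleteEdges_le _
  constructor
  · rintro ⟨p⟩
    induction p with
    | nil => exact Or.inl (SimpleGraph.Reachable.refl _)
    | @cons a c b h _ ih =>
      by_cases he : s(a, c) = s(u, v)
      · rw [Sym2.eq_iff] at he
        rcases he with ⟨rfl, rfl⟩ | ⟨rfl, rfl⟩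
        · rcases ih with h1 | ⟨h1, h2⟩ | ⟨h1, h2⟩
          · exact Or.inr (Or.inl ⟨.refl _, h1⟩)
          · exact Or.inr (Or.inl ⟨.refl _, h2⟩)
          · exact Or.inl h2
        · rcases ih with h1 | ⟨h1, h2⟩ | ⟨h1, h2⟩
          · exact Or.inr (Or.inr ⟨.refl _, h1⟩)
          · exact Or.inl h2
          · exact Or.inr (Or.inr ⟨.refl _, h2⟩)
      · have hac : G'.Reachable a c := ((del_adj G u v a c).2 ⟨h, he⟩).reachable
        rcases ih with h1 | ⟨h1, h2⟩ | ⟨h1, h2⟩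
        · exact Or.inl (hac.trans h1)
        · exact Or.inr (Or.inl ⟨hac.trans h1, h2⟩)
        · exact Or.inr (Or.inr ⟨hac.trans h1, h2⟩)
  · rintro (h | ⟨h1, h2⟩ | ⟨h1, h2⟩)
    · exact h.mono hle
    · exact (h1.mono hle).trans (huv.reachable.trans (h2.mono hle))
    · exact (h1.mono hle).trans (huv.symm.reachable.trans (h2.mono hle))

theorem SS_nonbridge {u v : V} (huv : G.Adj u v)
    (h : (G.deleteEdges {s(u, v)}).Reachable u v) (φ : ℕ → ℝ) :
    SS (G.deleteEdges {s(u, v)}) φ = SS G φ := by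
  unfold SS cs
  refine Finset.sum_congr rfl fun a _ => ?_
  congr 2
  ext b
  simp only [Finset.mem_filter, Finset.mem_univ, true_and]
  rw [reach_del G huv]
  constructor
  · exact Or.inl
  · rintro (h1 | ⟨h1, h2⟩ | ⟨h1, h2⟩)
    · exact h1
    · exact h1.trans (h.trans h2)
    · exact h1.trans (h.symm.trans h2)

theorem cs_congr {a b : V} (h : G.Reachable a b) : cs G a = cs G b := by
  unfold cs
  congr 1
  ext c
  simp only [Finset.mem_filter, Finset.mem_univ, true_and]
  exact ⟨fun h1 => h.symm.trans h1, fun h1 => h.trans h1⟩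

theorem cs_pos (a : V) : 1 ≤ cs G a := by
  unfold cs
  rw [Nat.one_le_iff_ne_zero, ← Nat.pos_iff_ne_zero, Finset.card_pos]
  exact ⟨a, by simp⟩

theorem cs_bridge {u v : V} (huv : G.Adj u v)
    (h : ¬ (G.deleteEdges {s(u, v)}).Reachable u v) :
    cs G u = cs (G.deleteEdges {s(u, v)}) u + cs (G.deleteEdges {s(u, v)}) v := by
  unfold cs
  rw [← Finset.card_union_of_disjoint]
  · congr 1
    ext b
    simp only [Finset.mem_filter, Finset.mem_univ, true_and, Finset.mem_union]
    rw [reach_del G huv]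
    have := SimpleGraph.Reachable.refl (G := G.deleteEdges {s(u, v)}) u
    tauto
  · rw [Finset.disjoint_left]
    intro b hb hb'
    simp only [Finset.mem_filter, Finset.mem_univ, true_and] at hb hb'
    exact h (hb.trans hb'.symm)

theorem SS_bridge {u v : V} (huv : G.Adj u v)
    (h : ¬ (G.deleteEdges {s(u, v)}).Reachable u v) (φ : ℕ → ℝ) :
    SS (G.deleteEdges {s(u, v)}) φ = SS G φ - (cs G u) * φ (cs G u)
      + (cs (G.deleteEdges {s(u, v)}) u) * φ (cs (G.deleteEdges {s(u, v)}) u)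
      + (cs (G.deleteEdges {s(u, v)}) v) * φ (cs (G.deleteEdges {s(u, v)}) v) := by
  set G' := G.deleteEdges {s(u, v)} with hG'
  have hle : G' ≤ G := SimpleGraph.deleteEdges_le _
  have hpt : ∀ w, φ (cs G' w) = φ (cs G w) + (if G'.Reachable u w then φ (cs G' u) - φ (cs G u) else 0)
      + (if G'.Reachable v w then φ (cs G' v) - φ (cs G u) else 0) := by
    intro w
    by_cases h1 : G'.Reachable u w
    · have h2 : ¬ G'.Reachable v w := fun h2 => h (h1.trans h2.symm)
      rw [if_pos h1, if_neg h2, cs_congr G' h1, cs_congr G (h1.mono hle)]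
      ring
    · by_cases h2 : G'.Reachable v w
      · rw [if_neg h1, if_pos h2, cs_congr G' h2, cs_congr G (huv.reachable.trans (h2.mono hle))]
        ring
      · rw [if_neg h1, if_neg h2, add_zero, add_zero]
        congr 1
        unfold cs
        congr 1
        ext b
        simp only [Finset.mem_filter, Finset.mem_univ, true_and]
        rw [reach_del G huv]
        have := @SimpleGraph.Reachable.symm _ G' w u
        have := @SimpleGraph.Reachable.symm _ G' w v
        tauto
  have hcb := cs_bridge G huv h
  unfold SS
  rw [Finset.sum_congr rfl (fun w _ => hpt w)]
  rw [Finset.sum_add_distrib, Finset.sum_add_distrib, ← Finset.sum_filter, ← Finset.sum_filter,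
    Finset.sum_const, Finset.sum_const, nsmul_eq_mul, nsmul_eq_mul]
  have e1 : (Finset.univ.filter (fun a => G'.Reachable u a)).card = cs G' u := by
    unfold cs; congr
  have e2 : (Finset.univ.filter (fun a => G'.Reachable v a)).card = cs G' v := by
    unfold cs; congr
  simp only [e1, e2]
  have : (cs G u : ℝ) = cs G' u + cs G' v := by exact_mod_cast hcb
  rw [this]; ring

theorem leaf_aux (hall : ∀ a b, G.Adj a b → ¬ (G.deleteEdges {s(a, b)}).Reachable a b) (n : ℕ) :
    ∀ u v, G.Adj u v → cs (G.deleteEdges {s(u, v)}) u = n →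
      ∃ u1 v1, G.Adj u1 v1 ∧ G.Reachable u u1 ∧ cs (G.deleteEdges {s(u1, v1)}) u1 = 1 := by
  induction n using Nat.strong_induction_on with
  | _ n ih =>
    intro u v huv hn
    by_cases h1 : cs (G.deleteEdges {s(u, v)}) u = 1
    · exact ⟨u, v, huv, .refl _, h1⟩
    have h2 : 1 < cs (G.deleteEdges {s(u, v)}) u := lt_of_le_of_ne (cs_pos _ _) (Ne.symm h1)
    obtain ⟨w, hw, hwu⟩ := Finset.exists_mem_ne h2 u
    simp only [Finset.mem_filter, Finset.mem_univ, true_and] at hw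
    obtain ⟨p⟩ := hw
    cases p with
    | nil => exact absurd rfl hwu
    | @cons _ u' _ had _ =>
      have had' := (del_adj G u v u u').1 had
      have hb := hall u' u had'.1.symm
      have hlt : cs (G.deleteEdges {s(u', u)}) u' < n := by
        rw [← hn]
        unfold cs
        apply Finset.card_lt_card
        rw [Finset.ssubset_iff_of_subset]
        · exact ⟨u, by simp, by simpa using hb⟩
        · intro x hx
          simp only [Finset.mem_filter, Finset.mem_univ, true_and] at hx ⊢
          have key : ∀ a b, (G.deleteEdges {s(u', u)}).Reachable a b →
              (G.deleteEdges {s(u', u)}).Reachable u' a →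
              (G.deleteEdges {s(u, v)}).Reachable u a → (G.deleteEdges {s(u, v)}).Reachable u b := by
            rintro a b ⟨q⟩
            induction q with
            | nil => exact fun _ h => h
            | @cons a c b h _ ihq =>
              intro k1 k2
              have k3 := k1.trans h.reachable
              refine ihq k3 (k2.trans (SimpleGraph.Adj.reachable ?_))
              rw [del_adj] at h ⊢
              refine ⟨h.1, fun he => ?_⟩
              rw [Sym2.eq_iff] at he
              rcases he with ⟨rfl, rfl⟩ | ⟨rfl, rfl⟩
              · exact hb k1
              · exact hb k3
          exact key u' x hx (.refl _) had.reachable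
      obtain ⟨u1, v1, r1, r2, r3⟩ := ih _ hlt u' u had'.1.symm rfl
      exact ⟨u1, v1, r1, had'.1.reachable.trans r2, r3⟩

/-- non-bridge behaviour of the statistic -/
def NB (e : Sym2 V) : Prop := ∀ φ, SS (G.deleteEdges {e}) φ = SS G φ

theorem NB_or (e : Sym2 V) (he : e ∈ G.edgeFinset) : NB G e ∨
    ∃ s s' : ℕ, 1 ≤ s ∧ 1 ≤ s' ∧ (∃ v, cs G v = s + s') ∧
      ∀ φ, SS (G.deleteEdges {e}) φ = SS G φ - ((s + s' : ℕ) : ℝ) * φ (s + s') + s * φ s + s' * φ s' := by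
  induction e with
  | _ u v =>
    have huv : G.Adj u v := by simpa using he
    by_cases h : (G.deleteEdges {s(u, v)}).Reachable u v
    · exact Or.inl (SS_nonbridge G huv h)
    · refine Or.inr ⟨_, _, cs_pos _ _, cs_pos _ _, ⟨u, cs_bridge G huv h⟩, fun φ => ?_⟩
      rw [← cs_bridge G huv h]
      exact SS_bridge G huv h φ

theorem leaf_edge (hall : ∀ e ∈ G.edgeFinset, ¬ NB G e) (p : ℕ) (hp : 2 ≤ p) (w : V)
    (hw : cs G w = p) : ∃ e ∈ G.edgeFinset, ∀ φ, SS (G.deleteEdges {e}) φ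
      = SS G φ - (p : ℝ) * φ p + φ 1 + ((p - 1 : ℕ) : ℝ) * φ (p - 1) := by
  have hall' : ∀ a b, G.Adj a b → ¬ (G.deleteEdges {s(a, b)}).Reachable a b := by
    intro a b hab hr
    exact hall s(a, b) (by simpa using hab) (SS_nonbridge G hab hr)
  have h2 : 1 < cs G w := by omega
  obtain ⟨w', hw', hne⟩ := Finset.exists_mem_ne h2 w
  simp only [Finset.mem_filter, Finset.mem_univ, true_and] at hw'
  obtain ⟨q⟩ := hw'
  cases q with
  | nil => exact absurd rfl hne
  | @cons _ u' _ had _ =>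
    obtain ⟨u1, v1, r1, r2, r3⟩ := leaf_aux G hall' _ w u' had rfl
    refine ⟨s(u1, v1), by simpa using r1, fun φ => ?_⟩
    have hb := cs_bridge G r1 (hall' _ _ r1)
    rw [SS_bridge G r1 (hall' _ _ r1), r3]
    rw [← cs_congr G r2, hw] at hb ⊢
    have : cs (G.deleteEdges {s(u1, v1)}) v1 = p - 1 := by omega
    rw [this]
    simp

end del

theorem arith (p s s' : ℕ) (hp : 2 ≤ p) (hs : 1 ≤ s) (hs' : 1 ≤ s') (hle : p ≤ s + s')
    (h1 : (1:ℝ) + ((p - 1 : ℕ) : ℝ) * (if p - 1 = 1 then 1 else 0)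
      = s * (if s = 1 then 1 else 0) + s' * (if s' = 1 then 1 else 0))
    (h2 : 3 ≤ p → ((p - 1 : ℕ) : ℝ) = s * (if s = p - 1 then 1 else 0)
      + s' * (if s' = p - 1 then 1 else 0)) :
    (s = 1 ∧ s' = p - 1) ∨ (s = p - 1 ∧ s' = 1) := by
  have h1' : 1 + (p - 1) * (if p - 1 = 1 then 1 else 0)
      = s * (if s = 1 then 1 else 0) + s' * (if s' = 1 then 1 else 0) := by
    exact_mod_cast h1
  have h2' : 3 ≤ p → (p - 1) = s * (if s = p - 1 then 1 else 0)
      + s' * (if s' = p - 1 then 1 else 0) := by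
    intro h; exact_mod_cast h2 h
  clear h1 h2
  by_cases hp3 : 3 ≤ p
  · have h2 := h2' hp3
    rw [if_neg (by omega)] at h1'
    split_ifs at h1' h2 <;> omega
  · have : p = 2 := by omega
    subst this
    split_ifs at h1' <;> omega

/-- indicator -/
noncomputable def dl (r : ℕ) : ℕ → ℝ := fun s => if s = r then 1 else 0

theorem SS_dl_zero {V : Type*} [Fintype V] (G : SimpleGraph V) (r : ℕ) (h : ∀ v, cs G v ≠ r) :
    SS G (dl r) = 0 := by
  unfold SS dl
  exact Finset.sum_eq_zero fun v _ => if_neg (h v)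

section recon
variable {V V' : Type*} [Fintype V] [Fintype V'] (G : SimpleGraph V) (H : SimpleGraph V')

theorem caseB (σ : {e : Sym2 V // e ∈ G.edgeFinset} ≃ {e : Sym2 V' // e ∈ H.edgeFinset})
    (hS : ∀ (e : {e : Sym2 V // e ∈ G.edgeFinset}) φ, SS (G.deleteEdges {(e : Sym2 V)}) φ =
      SS (H.deleteEdges {(σ e : Sym2 V')}) φ)
    (hiso : SS G (dl 1) = SS H (dl 1))
    (hG : ∀ e ∈ G.edgeFinset, ¬ NB G e) (hH : ∀ e ∈ H.edgeFinset, ¬ NB H e)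
    (w : V) (hw : 2 ≤ cs G w) (hGm : ∀ v, 2 ≤ cs G v → cs G w ≤ cs G v)
    (hHm : ∀ v, 2 ≤ cs H v → cs G w ≤ cs H v) (φ : ℕ → ℝ) : SS G φ = SS H φ := by
  obtain ⟨e, he, h1⟩ := leaf_edge G hG (cs G w) hw w rfl
  generalize cs G w = p at *
  obtain ⟨s, s', hs, hs', ⟨v, hv⟩, h2⟩ := (NB_or H (σ ⟨e, he⟩) (σ ⟨e, he⟩).2).resolve_left
    (hH _ (σ ⟨e, he⟩).2)
  have hle : p ≤ s + s' := by rw [← hv]; exact hHm v (by omega)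
  have key : ∀ φ, SS G φ - (p : ℝ) * φ p + φ 1 + ((p - 1 : ℕ) : ℝ) * φ (p - 1)
      = SS H φ - ((s + s' : ℕ) : ℝ) * φ (s + s') + s * φ s + s' * φ s' := by
    intro φ
    rw [← h1, ← h2]
    exact hS ⟨e, he⟩ φ
  have hh := arith p s s' hw hs hs' hle ?_ ?_
  · have k := key φ
    rcases hh with ⟨rfl, rfl⟩ | ⟨rfl, rfl⟩
    · have : 1 + (p - 1) = p := by omega
      rw [this] at k
      simp at k; linarith
    · have : (p - 1) + 1 = p := by omega
      rw [this] at k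
      simp at k; linarith
  · have k := key (dl 1)
    rw [hiso] at k
    have e1 : dl 1 p = 0 := if_neg (by omega)
    have e2 : dl 1 (s + s') = 0 := if_neg (by omega)
    have e3 : dl 1 1 = 1 := if_pos rfl
    rw [e1, e2, e3] at k
    unfold dl at k
    linarith
  · intro hp3
    have k := key (dl (p - 1))
    rw [SS_dl_zero G (p - 1), SS_dl_zero H (p - 1)] at k
    · have e1 : dl (p - 1) p = 0 := if_neg (by omega)
      have e2 : dl (p - 1) (s + s') = 0 := if_neg (by omega)
      have e3 : dl (p - 1) 1 = 0 := if_neg (by omega)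
      have e4 : dl (p - 1) (p - 1) = 1 := if_pos rfl
      rw [e1, e2, e3, e4] at k
      unfold dl at k
      linarith
    · intro v hv
      have := hHm v (by omega)
      omega
    · intro v hv
      have := hGm v (by omega)
      omega

theorem exists_big (h : G.edgeFinset.Nonempty) : ∃ w, 2 ≤ cs G w := by
  obtain ⟨e, he⟩ := h
  induction e with
  | _ u v =>
    have huv : G.Adj u v := by simpa using he
    refine ⟨u, ?_⟩
    have : ({u, v} : Finset V).card = 2 := Finset.card_pair huv.ne
    rw [← this]
    unfold cs
    apply Finset.card_le_card
    intro x hx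
    simp only [Finset.mem_insert, Finset.mem_singleton] at hx
    simp only [Finset.mem_filter, Finset.mem_univ, true_and]
    rcases hx with rfl | rfl
    · exact .refl _
    · exact huv.reachable

theorem exists_min (h : G.edgeFinset.Nonempty) :
    ∃ w, 2 ≤ cs G w ∧ ∀ v, 2 ≤ cs G v → cs G w ≤ cs G v := by
  obtain ⟨w, hw⟩ := exists_big G h
  obtain ⟨w, hw, hm⟩ := Finset.exists_min_image (Finset.univ.filter fun v => 2 ≤ cs G v) (cs G)
    ⟨w, by simpa using hw⟩
  exact ⟨w, by simpa using hw, fun v hv => hm v (by simpa using hv)⟩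

theorem NB_iff (e : Sym2 V) (he : e ∈ G.edgeFinset) :
    SS (G.deleteEdges {e}) (fun r => (r : ℝ)) ≤ SS G (fun r => (r : ℝ)) ∧
    (SS (G.deleteEdges {e}) (fun r => (r : ℝ)) = SS G (fun r => (r : ℝ)) → NB G e) := by
  rcases NB_or G e he with h | ⟨s, s', hs, hs', _, h⟩
  · exact ⟨(h _).le, fun _ => h⟩
  · have h1 : (1:ℝ) ≤ s := by exact_mod_cast hs
    have h2 : (1:ℝ) ≤ s' := by exact_mod_cast hs'
    rw [h]
    push_cast
    constructor
    · nlinarith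
    · intro h3; nlinarith

theorem caseC (σ : {e : Sym2 V // e ∈ G.edgeFinset} ≃ {e : Sym2 V' // e ∈ H.edgeFinset})
    (hS : ∀ (e : {e : Sym2 V // e ∈ G.edgeFinset}) φ, SS (G.deleteEdges {(e : Sym2 V)}) φ =
      SS (H.deleteEdges {(σ e : Sym2 V')}) φ)
    (hiso : SS G (dl 1) = SS H (dl 1)) (hne : G.edgeFinset.Nonempty)
    (hG : ∀ e ∈ G.edgeFinset, ¬ NB G e) : ∀ e ∈ H.edgeFinset, ¬ NB H e := by
  intro f hf hN
  obtain ⟨w, hw⟩ := exists_big G hne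
  obtain ⟨e, he, h1⟩ := leaf_edge G hG (cs G w) hw w rfl
  have br : ∀ {U : Type _} [Fintype U] (K : SimpleGraph U) (e : Sym2 U), e ∈ K.edgeFinset → ¬ NB K e →
      SS (K.deleteEdges {e}) (fun r => (r : ℝ)⁻¹) = SS K (fun r => (r : ℝ)⁻¹) + 1 := by
    intro U _ K e he hn
    obtain ⟨s, s', hs, hs', _, h⟩ := (NB_or K e he).resolve_left hn
    have h1 : (s:ℝ) ≠ 0 := by positivity
    have h2 : (s':ℝ) ≠ 0 := by positivity
    have h3 : ((s + s' : ℕ):ℝ) ≠ 0 := by positivity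
    rw [h, mul_inv_cancel₀ h1, mul_inv_cancel₀ h2, mul_inv_cancel₀ h3]
    ring
  have br' : ∀ {U : Type _} [Fintype U] (K : SimpleGraph U) (e : Sym2 U), e ∈ K.edgeFinset → ¬ NB K e →
      SS (K.deleteEdges {e}) (fun r => (r : ℝ)⁻¹) = SS K (fun r => (r : ℝ)⁻¹) + 1 := by
    intro U _ K e he hn
    obtain ⟨s, s', hs, hs', _, h⟩ := (NB_or K e he).resolve_left hn
    have h1 : (s:ℝ) ≠ 0 := by positivity
    have h2 : (s':ℝ) ≠ 0 := by positivity
    have h3 : ((s + s' : ℕ):ℝ) ≠ 0 := by positivity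
    rw [h, mul_inv_cancel₀ h1, mul_inv_cancel₀ h2, mul_inv_cancel₀ h3]
    ring
  have hbr : ¬ NB H (σ ⟨e, he⟩) := by
    intro hN'
    have k := hS ⟨e, he⟩ (dl 1)
    rw [hN', ← hiso, h1] at k
    have e1 : dl 1 (cs G w) = 0 := if_neg (by omega)
    have e3 : dl 1 1 = 1 := if_pos rfl
    have e4 : 0 ≤ dl 1 (cs G w - 1) := by unfold dl; split_ifs <;> norm_num
    rw [e1, e3] at k
    have : 0 ≤ ((cs G w - 1 : ℕ) : ℝ) * dl 1 (cs G w - 1) := by positivity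
    linarith
  have a1 := hS ⟨e, he⟩ (fun r => (r : ℝ)⁻¹)
  rw [br' H _ (σ ⟨e, he⟩).2 hbr] at a1
  have a2 := br G e he (hG e he)
  have a3 := hS (σ.symm ⟨f, hf⟩) (fun r => (r : ℝ)⁻¹)
  rw [σ.apply_symm_apply] at a3
  rw [hN] at a3
  have a4 := br G _ (σ.symm ⟨f, hf⟩).2 (hG _ (σ.symm ⟨f, hf⟩).2)
  simp only at a1
  linarith

theorem recon (σ : {e : Sym2 V // e ∈ G.edgeFinset} ≃ {e : Sym2 V' // e ∈ H.edgeFinset})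
    (hS : ∀ (e : {e : Sym2 V // e ∈ G.edgeFinset}) φ, SS (G.deleteEdges {(e : Sym2 V)}) φ =
      SS (H.deleteEdges {(σ e : Sym2 V')}) φ)
    (hiso : SS G (dl 1) = SS H (dl 1)) (hneG : G.edgeFinset.Nonempty)
    (hneH : H.edgeFinset.Nonempty) (φ : ℕ → ℝ) : SS G φ = SS H φ := by
  have hS' : ∀ (e : {e : Sym2 V' // e ∈ H.edgeFinset}) φ, SS (H.deleteEdges {(e : Sym2 V')}) φ =
      SS (G.deleteEdges {(σ.symm e : Sym2 V)}) φ := by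
    intro e φ
    rw [hS, σ.apply_symm_apply]
  by_cases hG : ∀ e ∈ G.edgeFinset, ¬ NB G e
  · have hH := caseC G H σ hS hiso hneG hG
    obtain ⟨w, hw, hwm⟩ := exists_min G hneG
    obtain ⟨w', hw', hwm'⟩ := exists_min H hneH
    rcases le_total (cs G w) (cs H w') with h | h
    · exact caseB G H σ hS hiso hG hH w hw hwm (fun v hv => h.trans (hwm' v hv)) φ
    · exact (caseB H G σ.symm hS' hiso.symm hH hG w' hw' hwm'
        (fun v hv => h.trans (hwm v hv)) φ).symm
  · by_cases hH : ∀ e ∈ H.edgeFinset, ¬ NB H e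
    · exact absurd (caseC H G σ.symm hS' hiso.symm hneH hH) hG
    · push Not at hG hH
      obtain ⟨e, he, hN⟩ := hG
      obtain ⟨f, hf, hN'⟩ := hH
      have a1 := hS ⟨e, he⟩ (fun r => (r : ℝ))
      have a2 := hS' ⟨f, hf⟩ (fun r => (r : ℝ))
      rw [hN] at a1
      rw [hN'] at a2
      have b1 := NB_iff H _ (σ ⟨e, he⟩).2
      have b2 := NB_iff G _ (σ.symm ⟨f, hf⟩).2
      have hN2 : NB H (σ ⟨e, he⟩) := b1.2 (by linarith [b1.1, b2.1])
      rw [← hN φ, ← hN2 φ]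
      exact hS ⟨e, he⟩ φ

theorem iso_SS : SS G (dl 1) = ((iso G).card : ℝ) := by
  unfold SS dl
  rw [Finset.sum_boole]
  congr 2
  ext v
  simp only [Finset.mem_filter, Finset.mem_univ, true_and, mem_iso]
  constructor
  · intro h w hw
    obtain ⟨x, hx⟩ := Finset.card_eq_one.1 h
    have h1 : v ∈ ({x} : Finset V) := by rw [← hx]; simp
    have h2 : w ∈ ({x} : Finset V) := by rw [← hx]; simpa using hw.reachable
    rw [Finset.mem_singleton] at h1 h2
    exact hw.ne (h1.trans h2.symm)
  · intro h
    unfold cs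
    rw [Finset.card_eq_one]
    refine ⟨v, ?_⟩
    ext w
    simp only [Finset.mem_filter, Finset.mem_univ, true_and, Finset.mem_singleton]
    constructor
    · rintro ⟨p⟩
      cases p with
      | nil => rfl
      | cons h' _ => exact absurd h' (h _)
    · rintro rfl; exact .refl _

end recon

end BPR

/-- Polynomial reconstruction: if `G` and `H` each have at least four edges and there is a
bijection `σ` between their edge sets such that `B(G−e) = B(H−σ(e))` for every edge `e` of
`G`, then `B(G) = B(H)`. -/
theorem bipartitionPoly_reconstructible {V V' : Type*} [Fintype V] [Fintype V']
    (G : SimpleGraph V) (H : SimpleGraph V')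
    (hG : 4 ≤ G.edgeFinset.card) (hH : 4 ≤ H.edgeFinset.card)
    (σ : {e : Sym2 V // e ∈ G.edgeFinset} ≃ {e : Sym2 V' // e ∈ H.edgeFinset})
    (hσ : ∀ (e : {e : Sym2 V // e ∈ G.edgeFinset}) (x y z : ℝ),
      bipartitionPoly (G.deleteEdges {(e : Sym2 V)}) x y z =
        bipartitionPoly (H.deleteEdges {((σ e : Sym2 V'))}) x y z) :
    ∀ x y z : ℝ, bipartitionPoly G x y z = bipartitionPoly H x y z := by
  have hm : G.edgeFinset.card = H.edgeFinset.card := by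
    have := Fintype.card_congr σ
    rwa [Fintype.card_coe, Fintype.card_coe] at this
  have hd := BPR.diff_eq G H σ hσ hm
  have hi : (BPR.iso G).card = (BPR.iso H).card :=
    BPR.iso_eq G H _ hG rfl hm.symm (fun x z => hd x 1 z)
  have hS : ∀ (e : {e : Sym2 V // e ∈ G.edgeFinset}) φ,
      BPR.SS (G.deleteEdges {(e : Sym2 V)}) φ = BPR.SS (H.deleteEdges {(σ e : Sym2 V')}) φ := by
    intro e φ
    refine BPR.SS_of_KK _ _ (fun x => ?_) φ
    rw [← BPR.B_closed, ← BPR.B_closed]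
    exact hσ e x 1 (-1)
  have hR := BPR.recon G H σ hS (by rw [BPR.iso_SS, BPR.iso_SS, hi])
    (Finset.card_pos.1 (by omega)) (Finset.card_pos.1 (by omega))
  have hn : Fintype.card V = Fintype.card V' := by
    have := hR (fun _ => 1)
    unfold BPR.SS at this
    simp at this
    exact_mod_cast this
  exact BPR.finish G H _ hd hi hn (BPR.KK_of_SS G H hR)
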